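/- arXiv:1510.01433 — 2 statements merged into one kernel-verified Lean document; each statement's English description precedes it below -/
import Mathlib

section
/- Orbit structure of pairs of primitive vectors: let D ∈ ℤ. The orbits of the diagonal SL(2,ℤ)-action on M_D are as follows: (1) if D = 0, there are exactly two orbits, represented by ((1,0),(1,0)) and ((1,0),(−1,0)); equivalently, (m,n) ∈ M₀ if and only if n = m or n = −m; (2) if D = 1 (resp. D = −1), M_D is a single orbit, represented by ((1,0),(0,1)) (resp. ((−1,0),(0,1))); (3) if |D| > 1, M_D consists of exactly φ(|D|) distinct orbits (φ Euler's totient function), represented by the pairs ((D,k),(0,1)) where k runs over a set of residues modulo D that are coprime to D. -/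
/-!
STATEMENT 11 (orbit structure of pairs of primitive integer vectors of fixed
determinant under the diagonal `SL(2,ℤ)` action).
-/

open Matrix

abbrev SL2Z := Matrix.SpecialLinearGroup (Fin 2) ℤ

/-- A vector of `ℤ²` is primitive if its coordinates are coprime. -/
def primZ (m : Fin 2 → ℤ) : Prop := Int.gcd (m 0) (m 1) = 1

/-- `M_D`: pairs of primitive vectors whose determinant (as columns of a
`2×2` matrix) equals `D`. -/
def MD (D : ℤ) : Set ((Fin 2 → ℤ) × (Fin 2 → ℤ)) :=
  {p | primZ p.1 ∧ primZ p.2 ∧ p.1 0 * p.2 1 - p.1 1 * p.2 0 = D}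

/-- `q` lies in the diagonal `SL(2,ℤ)`-orbit of `p`. -/
def orbRel (p q : (Fin 2 → ℤ) × (Fin 2 → ℤ)) : Prop :=
  ∃ γ : SL2Z, q = (γ.val.mulVec p.1, γ.val.mulVec p.2)

/-- Orbit membership spelled out in the entries of the acting matrix. -/
theorem orbRel_of_entries {p q : (Fin 2 → ℤ) × (Fin 2 → ℤ)} (a b c d : ℤ)
    (hdet : a * d - b * c = 1)
    (h₁₀ : q.1 0 = a * p.1 0 + b * p.1 1) (h₁₁ : q.1 1 = c * p.1 0 + d * p.1 1)
    (h₂₀ : q.2 0 = a * p.2 0 + b * p.2 1) (h₂₁ : q.2 1 = c * p.2 0 + d * p.2 1) :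
    orbRel p q := by
  refine ⟨⟨!![a, b; c, d], by rw [Matrix.det_fin_two_of, hdet]⟩, ?_⟩
  ext i <;> fin_cases i <;> simp [Matrix.mulVec, dotProduct, Fin.sum_univ_two, *]

/-- A primitive vector is the second column of an integral matrix of determinant one. -/
theorem primZ.exists_det_eq_one {n : Fin 2 → ℤ} (hn : primZ n) :
    ∃ a c : ℤ, a * n 1 - c * n 0 = 1 := by
  obtain ⟨u, v, h⟩ := Int.isCoprime_iff_gcd_eq_one.mpr hn
  exact ⟨v, -u, by linear_combination h⟩

/-- Every pair in `M_D` lies in the orbits of all `((D,k),(0,1))` with `k` in a fixed residue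
class modulo `D`, and this class is coprime to `D`. -/
theorem exists_orbRel_of_mem_MD {D : ℤ} {p : (Fin 2 → ℤ) × (Fin 2 → ℤ)} (hp : p ∈ MD D) :
    ∃ k₀ : ℤ, ∀ t : ℤ, Int.gcd (k₀ + D * t) D = 1 ∧
      orbRel (![D, k₀ + D * t], ![0, 1]) p := by
  obtain ⟨hm, hn, hD⟩ := hp
  obtain ⟨a, c, hac⟩ := hn.exists_det_eq_one
  obtain ⟨u, v, huv⟩ := Int.isCoprime_iff_gcd_eq_one.mpr hm
  have h₀ : p.1 0 = D * a + (a * p.1 1 - c * p.1 0) * p.2 0 := by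
    linear_combination (-p.1 0) * hac + a * hD
  have h₁ : p.1 1 = D * c + (a * p.1 1 - c * p.1 0) * p.2 1 := by
    linear_combination (-p.1 1) * hac + c * hD
  generalize a * p.1 1 - c * p.1 0 = k₀ at h₀ h₁
  refine ⟨k₀, fun t ↦ ⟨?_, ?_⟩⟩
  · rw [← Int.isCoprime_iff_gcd_eq_one, IsCoprime.add_mul_left_left_iff]
    exact ⟨u * p.2 0 + v * p.2 1, u * a + v * c, by
      linear_combination huv - u * h₀ - v * h₁⟩
  · refine orbRel_of_entries (a - t * p.2 0) (p.2 0) (c - t * p.2 1) (p.2 1) ?_ ?_ ?_ ?_ ?_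
    · linear_combination hac
    · simp only [Matrix.cons_val_zero, Matrix.cons_val_one]
      linear_combination h₀
    · simp only [Matrix.cons_val_zero, Matrix.cons_val_one]
      linear_combination h₁
    · simp
    · simp

/-- Pairs of determinant zero consist of primitive vectors equal up to sign. -/
theorem mem_MD_zero_iff (p : (Fin 2 → ℤ) × (Fin 2 → ℤ)) :
    p ∈ MD 0 ↔ primZ p.1 ∧ (p.2 = p.1 ∨ p.2 = -p.1) := by
  constructor
  · rintro ⟨hm, hn, hD⟩
    refine ⟨hm, ?_⟩
    obtain ⟨a, c, hac⟩ := hm.exists_det_eq_one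
    obtain ⟨u, v, huv⟩ := Int.isCoprime_iff_gcd_eq_one.mpr hn
    have h₀ : p.2 0 = (a * p.2 1 - c * p.2 0) * p.1 0 := by
      linear_combination (-p.2 0) * hac - a * hD
    have h₁ : p.2 1 = (a * p.2 1 - c * p.2 0) * p.1 1 := by
      linear_combination (-p.2 1) * hac - c * hD
    generalize a * p.2 1 - c * p.2 0 = k at h₀ h₁
    have hk : IsUnit k := IsUnit.of_mul_eq_one (u * p.1 0 + v * p.1 1) (by
      linear_combination huv - u * h₀ - v * h₁)
    rcases Int.isUnit_iff.mp hk with rfl | rfl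
    · left; ext i; fin_cases i <;> simp [h₀, h₁]
    · right; ext i; fin_cases i <;> simp [h₀, h₁]
  · rcases p with ⟨m, n⟩
    rintro ⟨hm, h⟩
    dsimp only at hm h
    rcases h with rfl | rfl
    · exact ⟨hm, hm, by ring⟩
    · refine ⟨hm, ?_, ?_⟩
      · simpa [primZ] using hm
      · simp only [Pi.neg_apply]; ring

/-- A pair in `M₀` is in the orbit of `((1,0),(1,0))` or of `((1,0),(-1,0))`. -/
theorem orbRel_of_mem_MD_zero {p : (Fin 2 → ℤ) × (Fin 2 → ℤ)} (hp : p ∈ MD 0) :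
    orbRel (![1, 0], ![1, 0]) p ∨ orbRel (![1, 0], -![1, 0]) p := by
  obtain ⟨hm, h⟩ := (mem_MD_zero_iff p).mp hp
  obtain ⟨a, c, hac⟩ := hm.exists_det_eq_one
  refine h.imp (fun h ↦ ?_) (fun h ↦ ?_) <;>
    exact orbRel_of_entries (p.1 0) (-a) (p.1 1) (-c) (by linear_combination hac)
      (by simp) (by simp) (by simp [h]) (by simp [h])

/-- The residue of `k` modulo `D` is an invariant of the orbit of `((D,k),(0,1))`. -/
theorem dvd_sub_of_orbRel {D k k' : ℤ}
    (h : orbRel (![D, k], ![0, 1]) (![D, k'], ![0, 1])) : D ∣ k' - k := by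
  obtain ⟨γ, hγ⟩ := h
  have e₁ := congrFun (congrArg Prod.fst hγ) 1
  have e₂ := congrFun (congrArg Prod.snd hγ) 1
  simp [Matrix.mulVec, dotProduct, Fin.sum_univ_two] at e₁ e₂
  exact ⟨γ.val 1 0, by rw [e₁, ← e₂]; ring⟩

/-- Euler's totient counts the residues `0 ≤ k < |D|` coprime to `D`. -/
theorem card_coprime_residues (D : ℤ) :
    Nat.card {k : ℤ // 0 ≤ k ∧ k < |D| ∧ Int.gcd k D = 1} = Nat.totient D.natAbs := by
  rw [Nat.totient_eq_card_lt_and_coprime]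
  refine Nat.card_congr
    { toFun := fun k ↦ ⟨k.1.natAbs, ?_, ?_⟩
      invFun := fun k ↦ ⟨k.1, by omega, ?_, ?_⟩
      left_inv := fun k ↦ Subtype.ext (Int.natAbs_of_nonneg k.2.1)
      right_inv := fun k ↦ Subtype.ext (Int.natAbs_natCast k.1) }
  · have h := k.2.2.1.trans_eq (Int.abs_eq_natAbs D)
    have h₀ := k.2.1
    omega
  · exact Nat.coprime_comm.mp k.2.2.2
  · rw [Int.abs_eq_natAbs]; exact_mod_cast k.2.1
  · exact Nat.coprime_comm.mp k.2.2

theorem orbit_structure_MD (D : ℤ) :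
    -- (1) `D = 0`: membership in `M₀` means `n = ±m`, and there are exactly two
    -- orbits, represented by `((1,0),(1,0))` and `((1,0),(−1,0))`
    (D = 0 →
      (∀ p : (Fin 2 → ℤ) × (Fin 2 → ℤ),
          p ∈ MD 0 ↔ primZ p.1 ∧ (p.2 = p.1 ∨ p.2 = -p.1)) ∧
      (∀ p ∈ MD 0, orbRel (![1,0], ![1,0]) p ∨ orbRel (![1,0], -![1,0]) p) ∧
      ¬ orbRel (![1,0], ![1,0]) (![1,0], -![1,0])) ∧
    -- (2) `D = 1`: a single orbit represented by `((1,0),(0,1))`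
    (D = 1 →
      (![1,0], ![0,1]) ∈ MD 1 ∧ ∀ p ∈ MD 1, orbRel (![1,0], ![0,1]) p) ∧
    -- (2') `D = −1`: a single orbit represented by `((−1,0),(0,1))`
    (D = -1 →
      (-![1,0], ![0,1]) ∈ MD (-1) ∧ ∀ p ∈ MD (-1), orbRel (-![1,0], ![0,1]) p) ∧
    -- (3) `|D| > 1`: exactly `φ(|D|)` orbits, represented by `((D,k),(0,1))`
    -- with `k` running over residues mod `D` coprime to `D`
    (1 < |D| →
      (∀ k : ℤ, Int.gcd k D = 1 → (![D, k], ![0,1]) ∈ MD D) ∧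
      (∀ p ∈ MD D, ∃ k : ℤ, 0 ≤ k ∧ k < |D| ∧ Int.gcd k D = 1 ∧
          orbRel (![D, k], ![0,1]) p) ∧
      (∀ k k' : ℤ, 0 ≤ k → k < |D| → 0 ≤ k' → k' < |D| →
          Int.gcd k D = 1 → Int.gcd k' D = 1 →
          orbRel (![D, k], ![0,1]) (![D, k'], ![0,1]) → k = k') ∧
      Nat.card {k : ℤ // 0 ≤ k ∧ k < |D| ∧ Int.gcd k D = 1} = Nat.totient D.natAbs) := by
  refine ⟨?_, ?_, ?_, fun hD ↦ ⟨?_, ?_, ?_, card_coprime_residues D⟩⟩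
  · rintro rfl
    refine ⟨mem_MD_zero_iff, fun p hp ↦ orbRel_of_mem_MD_zero hp, ?_⟩
    rintro ⟨γ, hγ⟩
    have h := congrFun ((congrArg Prod.fst hγ).trans (congrArg Prod.snd hγ).symm) 0
    simp at h
  · rintro rfl
    refine ⟨by simp [MD, primZ], fun p hp ↦ ?_⟩
    obtain ⟨k, hk⟩ := exists_orbRel_of_mem_MD hp
    simpa using (hk (-k)).2
  · rintro rfl
    refine ⟨by simp [MD, primZ], fun p hp ↦ ?_⟩
    obtain ⟨k, hk⟩ := exists_orbRel_of_mem_MD hp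
    simpa using (hk k).2
  · intro k hk
    exact ⟨by simpa [primZ, Int.gcd_comm] using hk, by simp [primZ], by simp⟩
  · intro p hp
    obtain ⟨k, hk⟩ := exists_orbRel_of_mem_MD hp
    have hD₀ : D ≠ 0 := by rintro rfl; simp at hD
    have h := hk (-(k / D))
    rw [show k + D * -(k / D) = k % D by rw [Int.emod_def]; ring] at h
    exact ⟨k % D, Int.emod_nonneg k hD₀, Int.emod_lt_abs k hD₀, h.1, h.2⟩
  · intro k k' hk₀ hk hk₀' hk' _ _ h
    have hdvd := (abs_dvd D _).mpr (dvd_sub_of_orbRel h)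
    have h₀ := Int.eq_zero_of_abs_lt_dvd hdvd (by rw [abs_lt]; constructor <;> linarith)
    linarith
end

section
/- Let m, n ∈ ℤ² be primitive vectors and z ∈ ℝ. (1) If the determinant of the matrix with columns m and n is nonzero, then Cor_{m,n}(ε,z) = ε² for all ε ∈ (0,1). (2) Cor_{m,m}(ε,z) = ε for all ε ∈ (0,1). (3) If n = −m, and either z ∈ ℤ with 0 < ε ≤ 1/2, or 2ε ≤ frac(2z), then Cor_{m,n}(ε,z) = 0. -/
open MeasureTheory Set

noncomputable section

instance : Fact ((0:ℝ) < 1) := ⟨one_pos⟩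

/-- The circle `ℝ/ℤ`. -/
abbrev T1 := AddCircle (1:ℝ)

/-- The map `S(u₁,u₂) = z + m₁u₁ + m₂u₂` on the torus `ℝ²/ℤ²`. -/
def Smap (z : ℝ) (m : Fin 2 → ℤ) (u : T1 × T1) : T1 :=
  (z : T1) + m 0 • u.1 + m 1 • u.2

/-- `C_m(ε) ⊂ ℝ²/ℤ²`: the points where `frac(z + m₁u₁ + m₂u₂) < ε`,
i.e. where `S(u)` lies in the image of `[0,ε)`. -/
def Cset (z : ℝ) (m : Fin 2 → ℤ) (ε : ℝ) : Set (T1 × T1) :=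
  {u | Smap z m u ∈ (fun r : ℝ => (r : T1)) '' Set.Ico 0 ε}

/-- The correlation `Cor_{m,n}(ε,z) = μ_{𝕋²}(C_m(ε) ∩ C_n(ε))`, with respect to
the probability Haar measure on `ℝ²/ℤ²`. -/
def Cor (z : ℝ) (m n : Fin 2 → ℤ) (ε : ℝ) : ℝ :=
  (volume (Cset z m ε ∩ Cset z n ε)).toReal

end

/-!
STATEMENT 12: for primitive `m, n ∈ ℤ²` and `z ∈ ℝ`:
(1) if `det(m|n) ≠ 0` then `Cor_{m,n}(ε,z) = ε²` for all `ε ∈ (0,1)`;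
(2) `Cor_{m,m}(ε,z) = ε` for all `ε ∈ (0,1)`;
(3) if `n = −m` and either `z ∈ ℤ` with `0 < ε ≤ 1/2`, or `2ε ≤ frac(2z)`,
then `Cor_{m,n}(ε,z) = 0`.
-/

/-- The character `u ↦ m₁u₁ + m₂u₂` of the torus `ℝ²/ℤ²`. -/
def torusChar (m : Fin 2 → ℤ) : T1 × T1 →+ T1 :=
  m 0 • AddMonoidHom.fst T1 T1 + m 1 • AddMonoidHom.snd T1 T1

theorem torusChar_apply (m : Fin 2 → ℤ) (u : T1 × T1) :
    torusChar m u = m 0 • u.1 + m 1 • u.2 := rfl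

theorem Smap_eq_add_torusChar (z : ℝ) (m : Fin 2 → ℤ) (u : T1 × T1) :
    Smap z m u = (z : T1) + torusChar m u := by
  rw [torusChar_apply, ← add_assoc]; rfl

theorem continuous_torusChar (m : Fin 2 → ℤ) : Continuous (torusChar m) := by
  change Continuous fun u : T1 × T1 => m 0 • u.1 + m 1 • u.2
  fun_prop

theorem exists_zsmul_eq_T1 {k : ℤ} (hk : k ≠ 0) (a : T1) : ∃ b : T1, k • b = a := by
  obtain ⟨r, rfl⟩ := QuotientAddGroup.mk_surjective a
  refine ⟨((r / k : ℝ) : T1), ?_⟩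
  have hk' : (k : ℝ) ≠ 0 := Int.cast_ne_zero.mpr hk
  rw [← AddCircle.coe_zsmul, zsmul_eq_mul, mul_div_cancel₀ r hk']

theorem torusChar_surjective {m : Fin 2 → ℤ} (hm : Int.gcd (m 0) (m 1) = 1) :
    Function.Surjective (torusChar m) := by
  intro a
  refine ⟨((m 0).gcdA (m 1) • a, (m 0).gcdB (m 1) • a), ?_⟩
  have h := Int.gcd_eq_gcd_ab (m 0) (m 1)
  rw [hm] at h
  rw [torusChar_apply, smul_smul, smul_smul, ← add_smul, ← h, Nat.cast_one, one_smul]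

theorem torusChar_prod_surjective {m n : Fin 2 → ℤ} (hdet : m 0 * n 1 - m 1 * n 0 ≠ 0) :
    Function.Surjective ((torusChar m).prod (torusChar n)) := by
  rintro ⟨a, b⟩
  obtain ⟨a, rfl⟩ := exists_zsmul_eq_T1 hdet a
  obtain ⟨b, rfl⟩ := exists_zsmul_eq_T1 hdet b
  refine ⟨(n 1 • a - m 1 • b, m 0 • b - n 0 • a), ?_⟩
  rw [AddMonoidHom.prod_apply, torusChar_apply, torusChar_apply]
  ext <;> dsimp only <;> module

instance : (volume : Measure (T1 × T1)).IsAddHaarMeasure :=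
  inferInstanceAs ((volume : Measure T1).prod (volume : Measure T1)).IsAddHaarMeasure

theorem volume_univ_torus : volume (univ : Set (T1 × T1)) = 1 := by
  rw [Measure.volume_eq_prod, ← univ_prod_univ, Measure.prod_prod]
  simp

theorem measurePreserving_torusChar {m : Fin 2 → ℤ} (hm : Int.gcd (m 0) (m 1) = 1) :
    MeasurePreserving (torusChar m) volume volume :=
  (torusChar m).measurePreserving (continuous_torusChar m) (torusChar_surjective hm)
    (by rw [volume_univ_torus]; simp)

theorem measurePreserving_Smap (z : ℝ) {m : Fin 2 → ℤ} (hm : Int.gcd (m 0) (m 1) = 1) :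
    MeasurePreserving (Smap z m) volume volume := by
  rw [funext (Smap_eq_add_torusChar z m)]
  exact (measurePreserving_add_left volume (z : T1)).comp (measurePreserving_torusChar hm)

theorem measurePreserving_Smap_prod (z : ℝ) {m n : Fin 2 → ℤ}
    (hdet : m 0 * n 1 - m 1 * n 0 ≠ 0) :
    MeasurePreserving (fun u => (Smap z m u, Smap z n u)) volume volume := by
  have h : MeasurePreserving ((torusChar m).prod (torusChar n)) volume volume :=
    AddMonoidHom.measurePreserving
      ((continuous_torusChar m).prodMk (continuous_torusChar n))
      (torusChar_prod_surjective hdet) rfl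
  simp only [Smap_eq_add_torusChar]
  exact (measurePreserving_add_left volume ((z : T1), (z : T1))).comp h

theorem coe_T1_eq_coe_iff {r s : ℝ} : (r : T1) = (s : T1) ↔ ∃ k : ℤ, r - s = k := by
  rw [← sub_eq_zero, ← AddCircle.coe_sub, AddCircle.coe_eq_zero_iff]
  simp only [zsmul_eq_mul, mul_one, eq_comm]

theorem eq_of_coe_T1_eq_coe {r s : ℝ} (h : (r : T1) = (s : T1)) (hlt : |r - s| < 1) :
    r = s := by
  obtain ⟨k, hk⟩ := coe_T1_eq_coe_iff.mp h
  rw [hk] at hlt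
  have hk0 : k = 0 := Int.abs_lt_one_iff.mp (by exact_mod_cast hlt)
  rw [hk0, Int.cast_zero] at hk
  exact sub_eq_zero.mp hk

theorem measurableSet_arc {ε : ℝ} (hε : ε < 1) :
    MeasurableSet ((fun r : ℝ => (r : T1)) '' Ico 0 ε) := by
  refine measurableSet_Ico.image_of_continuousOn_injOn
    (AddCircle.continuous_mk' (1 : ℝ)).continuousOn ?_
  intro r hr s hs h
  exact eq_of_coe_T1_eq_coe h (abs_lt.mpr ⟨by linarith [hr.1, hs.2], by linarith [hr.2, hs.1]⟩)

theorem volume_arc {ε : ℝ} (hε : ε ∈ Ioo (0 : ℝ) 1) :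
    volume ((fun r : ℝ => (r : T1)) '' Ico 0 ε) = ENNReal.ofReal ε := by
  obtain ⟨h0, h1⟩ := hε
  rw [AddCircle.add_projection_respects_measure 1 (ε - 1) (measurableSet_arc h1)]
  have : ((QuotientAddGroup.mk : ℝ → T1) ⁻¹' ((fun r : ℝ => (r : T1)) '' Ico 0 ε)) ∩
      Ioc (ε - 1) (ε - 1 + 1) = Ico 0 ε := by
    ext r
    constructor
    · rintro ⟨⟨s, hs, h⟩, hr⟩
      have hsr : s = r := eq_of_coe_T1_eq_coe h
        (abs_lt.mpr ⟨by linarith [hr.2, hs.1], by linarith [hr.1, hs.2]⟩)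
      exact hsr ▸ hs
    · intro hr
      exact ⟨⟨r, hr, rfl⟩, by linarith [hr.1], by linarith [hr.2]⟩
  rw [this, Real.volume_Ico, sub_zero]

theorem Cor_of_det_ne_zero (z : ℝ) {m n : Fin 2 → ℤ} (hdet : m 0 * n 1 - m 1 * n 0 ≠ 0)
    {ε : ℝ} (hε : ε ∈ Ioo (0 : ℝ) 1) : Cor z m n ε = ε ^ 2 := by
  have hA := measurableSet_arc hε.2
  have h := (measurePreserving_Smap_prod z hdet).measure_preimage (hA.prod hA).nullMeasurableSet
  rw [Measure.volume_eq_prod, Measure.prod_prod, volume_arc hε, ← Measure.volume_eq_prod] at h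
  have hpre : Cset z m ε ∩ Cset z n ε = (fun u => (Smap z m u, Smap z n u)) ⁻¹'
      (((fun r : ℝ => (r : T1)) '' Ico 0 ε) ×ˢ ((fun r : ℝ => (r : T1)) '' Ico 0 ε)) := rfl
  rw [Cor, hpre, h, ENNReal.toReal_mul, ENNReal.toReal_ofReal hε.1.le, sq]

theorem Cor_self (z : ℝ) {m : Fin 2 → ℤ} (hm : Int.gcd (m 0) (m 1) = 1)
    {ε : ℝ} (hε : ε ∈ Ioo (0 : ℝ) 1) : Cor z m m ε = ε := by
  have h := (measurePreserving_Smap z hm).measure_preimage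
    (measurableSet_arc hε.2).nullMeasurableSet
  rw [volume_arc hε] at h
  rw [Cor, inter_self]
  change (volume (Smap z m ⁻¹' _)).toReal = _
  rw [h, ENNReal.toReal_ofReal hε.1.le]

theorem volume_singleton_zero_T1 : volume ({0} : Set T1) = 0 := by
  simpa using AddCircle.volume_closedBall (T := 1) (x := 0) 0

theorem Smap_add_Smap_neg (z : ℝ) (m : Fin 2 → ℤ) (u : T1 × T1) :
    Smap z m u + Smap z (-m) u = ((2 * z : ℝ) : T1) := by
  rw [two_mul, AddCircle.coe_add]
  simp only [Smap, Pi.neg_apply]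
  module

/-- On `C_m(ε) ∩ C_{-m}(ε)` the two representatives in `[0,ε)` add up to `frac(2z)`
when `2ε ≤ 1`. -/
theorem exists_add_eq_fract_of_mem_Cset_neg {z ε : ℝ} {m : Fin 2 → ℤ} (hε : 2 * ε ≤ 1)
    {u : T1 × T1} (hu : u ∈ Cset z m ε ∩ Cset z (-m) ε) :
    ∃ r ∈ Ico 0 ε, ∃ s ∈ Ico 0 ε, Smap z m u = (r : T1) ∧ r + s = Int.fract (2 * z) := by
  obtain ⟨⟨r, hr, hru⟩, s, hs, hsu⟩ := hu
  refine ⟨r, hr, s, hs, hru.symm, ?_⟩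
  have h : ((r + s : ℝ) : T1) = ((2 * z : ℝ) : T1) := by
    rw [← Smap_add_Smap_neg z m u, ← hru, ← hsu, AddCircle.coe_add]
  obtain ⟨k, hk⟩ := coe_T1_eq_coe_iff.mp h
  refine (Int.fract_eq_iff.mpr ⟨by linarith [hr.1, hs.1], by linarith [hr.2, hs.2], -k, ?_⟩).symm
  push_cast
  linarith

theorem Cor_neg_of_int (k : ℤ) {m : Fin 2 → ℤ} (hm : Int.gcd (m 0) (m 1) = 1)
    {ε : ℝ} (hε : ε ≤ 1 / 2) : Cor k m (-m) ε = 0 := by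
  have hsub : Cset k m ε ∩ Cset k (-m) ε ⊆ Smap k m ⁻¹' {0} := by
    intro u hu
    obtain ⟨r, hr, s, hs, hru, hrs⟩ := exists_add_eq_fract_of_mem_Cset_neg (by linarith) hu
    have hfr : Int.fract (2 * (k : ℝ)) = 0 := by
      rw [Int.fract_eq_zero_iff]
      exact ⟨2 * k, by push_cast; ring⟩
    have hr0 : r = 0 := by linarith [hr.1, hs.1]
    rw [mem_preimage, mem_singleton_iff, hru, hr0, AddCircle.coe_zero]
  have hzero := (measurePreserving_Smap k hm).measure_preimage
    (measurableSet_singleton (0 : T1)).nullMeasurableSet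
  rw [volume_singleton_zero_T1] at hzero
  rw [Cor, measure_mono_null hsub hzero, ENNReal.toReal_zero]

theorem Cor_neg_of_two_mul_le_fract {z ε : ℝ} (m : Fin 2 → ℤ)
    (hε : 2 * ε ≤ Int.fract (2 * z)) : Cor z m (-m) ε = 0 := by
  have hempty : Cset z m ε ∩ Cset z (-m) ε = ∅ := by
    refine eq_empty_of_forall_notMem fun u hu => ?_
    obtain ⟨r, hr, s, hs, -, hrs⟩ := exists_add_eq_fract_of_mem_Cset_neg
      (hε.trans (Int.fract_lt_one _).le) hu
    linarith [hr.2, hs.2]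
  rw [Cor, hempty, measure_empty, ENNReal.toReal_zero]

theorem correlation_values
    (m n : Fin 2 → ℤ) (hm : Int.gcd (m 0) (m 1) = 1) (hn : Int.gcd (n 0) (n 1) = 1)
    (z : ℝ) :
    -- (1) nonzero determinant: the correlation is `ε²`
    ((m 0 * n 1 - m 1 * n 0 ≠ 0) →
      ∀ ε : ℝ, ε ∈ Set.Ioo (0:ℝ) 1 → Cor z m n ε = ε ^ 2) ∧
    -- (2) equal vectors: the correlation is `ε`
    (∀ ε : ℝ, ε ∈ Set.Ioo (0:ℝ) 1 → Cor z m m ε = ε) ∧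
    -- (3) opposite vectors: the correlation vanishes
    (n = -m →
      ∀ ε : ℝ,
        (((∃ k : ℤ, z = (k : ℝ)) ∧ 0 < ε ∧ ε ≤ 1/2) ∨
          (0 < ε ∧ ε < 1 ∧ 2 * ε ≤ Int.fract (2 * z))) →
        Cor z m n ε = 0) := by
  refine ⟨fun hdet ε hε => Cor_of_det_ne_zero z hdet hε, fun ε hε => Cor_self z hm hε, ?_⟩
  rintro rfl ε (⟨⟨k, rfl⟩, -, hε⟩ | ⟨-, -, hε⟩)
  · exact Cor_neg_of_int k hm hε
  · exact Cor_neg_of_two_mul_le_fract m hε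
end
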